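/- Converse part of the quantum Hoeffding bound: let ρ and σ be faithful density operators on a finite-dimensional complex Hilbert space and let Φ(a) := max_{0≤s≤1}(a·s − φ(s)) and Ψ(a) := Φ(a) − a with φ(s) := log Tr[ρ^{1−s}σ^{s}]. Then for every a with −D(ρ‖σ) ≤ a < D(σ‖ρ) and every sequence of tests {T_n} (0 ≤ T_n ≤ I on the n-fold tensor power space): if limsup_{n→∞} (1/n)·log Tr[σ^{⊗n} T_n] ≤ −Ψ(a), then liminf_{n→∞} (1/n)·log Tr[ρ^{⊗n}(I − T_n)] ≥ −a − Ψ(a). -/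

import Mathlib

open scoped Matrix ComplexOrder
open Filter

noncomputable section

/-- Real power of a matrix, taken via the spectral decomposition when the matrix is
Hermitian (with the convention `0 ^ t` given by `Real.rpow`), and `0` otherwise. -/
def mpow {n : Type*} [Fintype n] [DecidableEq n] (A : Matrix n n ℂ) (t : ℝ) : Matrix n n ℂ :=
  if h : A.IsHermitian then
    (Matrix.IsHermitian.eigenvectorUnitary h : Matrix n n ℂ) *
      Matrix.diagonal (fun i => ((h.eigenvalues i ^ t : ℝ) : ℂ)) *
      (star (Matrix.IsHermitian.eigenvectorUnitary h : Matrix n n ℂ))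
  else 0

/-- Logarithm of a matrix via the spectral decomposition (Hermitian case), `0` otherwise. -/
def mlog {n : Type*} [Fintype n] [DecidableEq n] (A : Matrix n n ℂ) : Matrix n n ℂ :=
  if h : A.IsHermitian then
    (Matrix.IsHermitian.eigenvectorUnitary h : Matrix n n ℂ) *
      Matrix.diagonal (fun i => ((Real.log (h.eigenvalues i) : ℝ) : ℂ)) *
      (star (Matrix.IsHermitian.eigenvectorUnitary h : Matrix n n ℂ))
  else 0

/-- Exponential of a matrix via the spectral decomposition (Hermitian case), `0` otherwise. -/
def mexp {n : Type*} [Fintype n] [DecidableEq n] (A : Matrix n n ℂ) : Matrix n n ℂ :=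
  if h : A.IsHermitian then
    (Matrix.IsHermitian.eigenvectorUnitary h : Matrix n n ℂ) *
      Matrix.diagonal (fun i => ((Real.exp (h.eigenvalues i) : ℝ) : ℂ)) *
      (star (Matrix.IsHermitian.eigenvectorUnitary h : Matrix n n ℂ))
  else 0

/-- The orthogonal projection onto the span of the eigenvectors of a Hermitian matrix
corresponding to positive eigenvalues, denoted `{A > 0}` in the paper; `0` otherwise. -/
def posProj {n : Type*} [Fintype n] [DecidableEq n] (A : Matrix n n ℂ) : Matrix n n ℂ :=
  if h : A.IsHermitian then
    (Matrix.IsHermitian.eigenvectorUnitary h : Matrix n n ℂ) *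
      Matrix.diagonal (fun i => if 0 < h.eigenvalues i then (1 : ℂ) else 0) *
      (star (Matrix.IsHermitian.eigenvectorUnitary h : Matrix n n ℂ))
  else 0

/-- The `n`-fold tensor (Kronecker) power `ρ^{⊗n}`, as a matrix indexed by `Fin n → Fin d`. -/
def tensorPow {d : ℕ} (ρ : Matrix (Fin d) (Fin d) ℂ) (n : ℕ) :
    Matrix (Fin n → Fin d) (Fin n → Fin d) ℂ :=
  fun v w => ∏ t, ρ (v t) (w t)

/-- Quantum relative entropy `D(ρ‖σ) = Tr[ρ(log ρ − log σ)]`. -/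
def qRelEnt {d : ℕ} (ρ σ : Matrix (Fin d) (Fin d) ℂ) : ℝ :=
  ((ρ * (mlog ρ - mlog σ)).trace).re

/-- `φ(s | ρ‖σ) = log Tr[ρ^{1−s} σ^{s}]`. -/
def qphi {d : ℕ} (ρ σ : Matrix (Fin d) (Fin d) ℂ) (s : ℝ) : ℝ :=
  Real.log (((mpow ρ (1 - s)) * (mpow σ s)).trace.re)

theorem tp_mul {d : ℕ} (A B : Matrix (Fin d) (Fin d) ℂ) (n : ℕ) :
    tensorPow A n * tensorPow B n = tensorPow (A * B) n := by
  ext v w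
  simp only [tensorPow, Matrix.mul_apply]
  rw [Finset.prod_univ_sum]
  simp [Finset.prod_mul_distrib]

theorem tp_star {d : ℕ} (A : Matrix (Fin d) (Fin d) ℂ) (n : ℕ) :
    (tensorPow A n)ᴴ = tensorPow Aᴴ n := by
  ext v w
  simp [tensorPow, Matrix.conjTranspose_apply]

theorem tp_diag {d : ℕ} (a : Fin d → ℝ) (n : ℕ) :
    tensorPow (Matrix.diagonal (fun i => (a i : ℂ))) n
      = Matrix.diagonal (fun v : Fin n → Fin d => ((∏ t, a (v t) : ℝ) : ℂ)) := by
  ext v w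
  simp only [tensorPow, Matrix.diagonal_apply]
  by_cases h : v = w
  · subst h; simp
  · rw [if_neg h]
    obtain ⟨t, ht⟩ := Function.ne_iff.mp h
    exact Finset.prod_eq_zero (Finset.mem_univ t) (if_neg ht)

theorem tp_one {d : ℕ} (n : ℕ) :
    tensorPow (1 : Matrix (Fin d) (Fin d) ℂ) n = 1 := by
  have := tp_diag (d := d) (fun _ => 1) n
  simpa using this

theorem trace_two {N : Type*} [Fintype N] [DecidableEq N] (U V : Matrix N N ℂ) (a b : N → ℝ) :
    ((U * Matrix.diagonal (fun i => (a i : ℂ)) * Uᴴ) *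
      (V * Matrix.diagonal (fun i => (b i : ℂ)) * Vᴴ)).trace.re
      = ∑ i, ∑ j, a i * b j * ‖(Uᴴ * V) i j‖ ^ 2 := by
  have h : ((U * Matrix.diagonal (fun i => (a i : ℂ)) * Uᴴ) *
      (V * Matrix.diagonal (fun i => (b i : ℂ)) * Vᴴ)).trace
      = (Matrix.diagonal (fun i => (a i : ℂ)) * (Uᴴ * V) *
        (Matrix.diagonal (fun i => (b i : ℂ)) * (Uᴴ * V)ᴴ)).trace := by
    rw [Matrix.conjTranspose_mul, Matrix.conjTranspose_conjTranspose]
    simp only [Matrix.mul_assoc]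
    rw [Matrix.trace_mul_comm]
    simp only [Matrix.mul_assoc]
  rw [h, Matrix.trace]
  simp only [Matrix.diag_apply, Matrix.mul_apply (M := Matrix.diagonal _ * _),
    Matrix.diagonal_mul, Matrix.conjTranspose_apply, Complex.re_sum]
  refine Finset.sum_congr rfl fun i _ => Finset.sum_congr rfl fun j _ => ?_
  rw [← Complex.normSq_eq_norm_sq, Complex.normSq_apply]
  simp only [Complex.star_def, Complex.mul_re, Complex.ofReal_re, Complex.ofReal_im,
    Complex.conj_re, Complex.conj_im, Complex.mul_im]
  ring

theorem trace_diag_nonneg {N : Type*} [Fintype N] [DecidableEq N] (U M : Matrix N N ℂ)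
    (a : N → ℝ) (ha : ∀ i, 0 ≤ a i) (hM : M.PosSemidef) :
    0 ≤ ((U * Matrix.diagonal (fun i => (a i : ℂ)) * Uᴴ) * M).trace.re := by
  have h : ((U * Matrix.diagonal (fun i => (a i : ℂ)) * Uᴴ) * M).trace
      = (Matrix.diagonal (fun i => (a i : ℂ)) * (Uᴴ * M * U)).trace := by
    simp only [Matrix.mul_assoc]
    rw [Matrix.trace_mul_comm]
    simp only [Matrix.mul_assoc]
  rw [h, Matrix.trace]
  simp only [Matrix.diag_apply, Matrix.diagonal_mul, Complex.re_sum]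
  refine Finset.sum_nonneg fun i _ => ?_
  have h2 := (hM.conjTranspose_mul_mul_same U).diag_nonneg (i := i)
  have := (Complex.le_def.mp h2).1
  simp only [Complex.mul_re, Complex.ofReal_re, Complex.ofReal_im]
  simp at this
  have := mul_nonneg (ha i) this
  linarith

theorem psd_sub_sq {N : Type*} [Fintype N] [DecidableEq N] (T : Matrix N N ℂ)
    (h : T.PosSemidef) (h' : (1 - T).PosSemidef) : (T - T * T).PosSemidef := by
  have e1 := h'.conjTranspose_mul_mul_same T
  have e2 := h.conjTranspose_mul_mul_same (1 - T)
  rw [h.1.eq] at e1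
  rw [h'.1.eq] at e2
  have := e1.add e2
  have e : T * (1 - T) * T + (1 - T) * T * (1 - T) = T - T * T := by noncomm_ring
  rwa [e] at this

/-- `Tr[ρ T] ≥ ∑ λ_i |⟨x_i|T|y_j⟩|²`. -/
theorem trace_test_ge {N : Type*} [Fintype N] [DecidableEq N] (U V T : Matrix N N ℂ)
    (a : N → ℝ) (ha : ∀ i, 0 ≤ a i) (hV : V * Vᴴ = 1)
    (h : T.PosSemidef) (h' : (1 - T).PosSemidef) :
    ∑ i, ∑ j, a i * ‖(Uᴴ * T * V) i j‖ ^ 2 ≤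
      ((U * Matrix.diagonal (fun i => (a i : ℂ)) * Uᴴ) * T).trace.re := by
  have h1 := trace_diag_nonneg U _ a ha (psd_sub_sq T h h')
  rw [Matrix.mul_sub, Matrix.trace_sub, Complex.sub_re] at h1
  have h2 := trace_two U (T * V) a (fun _ => 1)
  have e : (T * V * Matrix.diagonal (fun _ => ((1:ℝ):ℂ)) * (T * V)ᴴ) = T * T := by
    simp only [Complex.ofReal_one, Matrix.diagonal_one, Matrix.mul_one,
      Matrix.conjTranspose_mul, h.1.eq]
    rw [Matrix.mul_assoc, ← Matrix.mul_assoc V, hV, Matrix.one_mul]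
  rw [e] at h2
  simp only [mul_one, ← Matrix.mul_assoc] at h2 h1
  linarith

theorem test_bound {N : Type*} [Fintype N] [DecidableEq N] (U V T : Matrix N N ℂ)
    (a b : N → ℝ) (ha : ∀ i, 0 ≤ a i) (hb : ∀ i, 0 ≤ b i) (hU : U * Uᴴ = 1) (hV : V * Vᴴ = 1)
    (h : T.PosSemidef) (h' : (1 - T).PosSemidef) (c : ℝ) (hc : 0 ≤ c) :
    (1 / 2) * ∑ i, ∑ j, min (a i) (c * b j) * ‖(Uᴴ * V) i j‖ ^ 2 ≤
      ((U * Matrix.diagonal (fun i => (a i : ℂ)) * Uᴴ) * (1 - T)).trace.re +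
      c * ((V * Matrix.diagonal (fun i => (b i : ℂ)) * Vᴴ) * T).trace.re := by
  have h1 := trace_test_ge U V (1 - T) a ha hV h' (by simpa using h)
  have h2 := trace_test_ge V U T b hb hU h h'
  have h3 := mul_le_mul_of_nonneg_left h2 hc
  refine le_trans ?_ (add_le_add h1 h3)
  rw [Finset.sum_comm (f := fun i j => b i * ‖(Vᴴ * T * U) i j‖ ^ 2)]
  simp only [Finset.mul_sum]
  rw [← Finset.sum_add_distrib]
  refine Finset.sum_le_sum fun i _ => ?_
  rw [← Finset.sum_add_distrib]
  refine Finset.sum_le_sum fun j _ => ?_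
  have e1 : (Vᴴ * T * U) j i = star ((Uᴴ * T * V) i j) := by
    have e0 : Vᴴ * T * U = (Uᴴ * T * V)ᴴ := by
      simp only [Matrix.conjTranspose_mul, h.1.eq, Matrix.mul_assoc,
        Matrix.conjTranspose_conjTranspose]
    rw [e0, Matrix.conjTranspose_apply]
  have e2 : (Uᴴ * V) i j = (Uᴴ * (1 - T) * V) i j + (Uᴴ * T * V) i j := by
    have e0 : Uᴴ * V = Uᴴ * (1 - T) * V + Uᴴ * T * V := by
      simp only [Matrix.mul_sub, Matrix.sub_mul, Matrix.mul_one, sub_add_cancel]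
    rw [← Matrix.add_apply, ← e0]
  rw [e1, e2, norm_star]
  set x := (Uᴴ * (1 - T) * V) i j
  set y := (Uᴴ * T * V) i j
  have n1 := norm_add_le x y
  have n2 : ‖x + y‖ ^ 2 ≤ 2 * (‖x‖ ^ 2 + ‖y‖ ^ 2) := by
    nlinarith [norm_nonneg (x + y), sq_nonneg (‖x‖ - ‖y‖)]
  have m0 : 0 ≤ min (a i) (c * b j) := le_min (ha i) (mul_nonneg hc (hb j))
  have m1 := mul_le_mul_of_nonneg_right (min_le_left (a i) (c * b j)) (sq_nonneg ‖x‖)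
  have m2 := mul_le_mul_of_nonneg_right (min_le_right (a i) (c * b j)) (sq_nonneg ‖y‖)
  have m3 := mul_le_mul_of_nonneg_left n2 m0
  nlinarith

theorem moments {K : Type*} [Fintype K] (R X : K → ℝ)
    (h1 : ∑ k, R k = 1) (hX : ∑ k, R k * X k = 0) (n : ℕ) :
    (∑ k : Fin n → K, ∏ t, R (k t)) = 1 ∧
    (∑ k : Fin n → K, (∏ t, R (k t)) * ∑ t, X (k t)) = 0 ∧
    (∑ k : Fin n → K, (∏ t, R (k t)) * (∑ t, X (k t)) ^ 2) = n * ∑ k, R k * X k ^ 2 := by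
  induction n with
  | zero => simp
  | succ n ih =>
    obtain ⟨i1, i2, i3⟩ := ih
    have key : ∀ f : (Fin (n+1) → K) → ℝ,
        ∑ k, f k = ∑ x : K, ∑ k : Fin n → K, f (Fin.cons x k) := by
      intro f
      rw [← (Fin.consEquiv (fun _ : Fin (n+1) => K)).sum_comp, Fintype.sum_prod_type]
      rfl
    simp only [key, Fin.prod_univ_succ, Fin.sum_univ_succ, Fin.cons_zero, Fin.cons_succ]
    refine ⟨?_, ?_, ?_⟩
    · simp only [← Finset.mul_sum, i1, h1, mul_one]
    · have : ∀ x : K, ∑ k : Fin n → K, R x * (∏ t, R (k t)) * (X x + ∑ t, X (k t))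
          = R x * X x := by
        intro x
        calc _ = R x * X x * (∑ k : Fin n → K, ∏ t, R (k t)) +
              R x * ∑ k : Fin n → K, (∏ t, R (k t)) * ∑ t, X (k t) := by
              rw [Finset.mul_sum, Finset.mul_sum, ← Finset.sum_add_distrib]
              exact Finset.sum_congr rfl fun k _ => by ring
          _ = _ := by rw [i1, i2]; ring
      simp only [this, hX]
    · have : ∀ x : K, ∑ k : Fin n → K, R x * (∏ t, R (k t)) * (X x + ∑ t, X (k t)) ^ 2
          = R x * X x ^ 2 + R x * (n * ∑ k, R k * X k ^ 2) := by
        intro x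
        calc _ = R x * X x ^ 2 * (∑ k : Fin n → K, ∏ t, R (k t)) +
              2 * R x * X x * (∑ k : Fin n → K, (∏ t, R (k t)) * ∑ t, X (k t)) +
              R x * ∑ k : Fin n → K, (∏ t, R (k t)) * (∑ t, X (k t)) ^ 2 := by
              rw [Finset.mul_sum, Finset.mul_sum, Finset.mul_sum, ← Finset.sum_add_distrib,
                ← Finset.sum_add_distrib]
              exact Finset.sum_congr rfl fun k _ => by ring
          _ = _ := by rw [i1, i2, i3]; ring
      simp only [this, Finset.sum_add_distrib, ← Finset.sum_mul, h1]
      push_cast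
      ring

theorem wlln {K : Type*} [Fintype K] (R X : K → ℝ) (hR : ∀ k, 0 ≤ R k)
    (h1 : ∑ k, R k = 1) (hX : ∑ k, R k * X k = 0) (δ : ℝ) (hδ : 0 < δ) :
    ∀ᶠ n : ℕ in atTop, (1 / 2 : ℝ) ≤
      ∑ k : Fin n → K, if |∑ t, X (k t)| ≤ n * δ then ∏ t, R (k t) else 0 := by
  set Vv := ∑ k, R k * X k ^ 2
  filter_upwards [eventually_gt_atTop 0,
    tendsto_natCast_atTop_atTop.eventually_ge_atTop (2 * Vv / δ ^ 2)] with n hn0 hn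
  obtain ⟨m1, -, m3⟩ := moments R X h1 hX n
  have hnpos : (0:ℝ) < n := by exact_mod_cast hn0
  have hs : 0 < (n * δ) ^ 2 := by positivity
  have hle : ∀ k : Fin n → K, (∏ t, R (k t)) - (∏ t, R (k t)) * (∑ t, X (k t)) ^ 2 / (n * δ) ^ 2
      ≤ if |∑ t, X (k t)| ≤ n * δ then ∏ t, R (k t) else 0 := by
    intro k
    have hp : 0 ≤ ∏ t, R (k t) := Finset.prod_nonneg fun t _ => hR _
    split_ifs with h
    · have : 0 ≤ (∏ t, R (k t)) * (∑ t, X (k t)) ^ 2 / (n * δ) ^ 2 := by positivity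
      linarith
    · push Not at h
      have : (n * δ) ^ 2 ≤ (∑ t, X (k t)) ^ 2 := by
        rw [← sq_abs (∑ t, X (k t))]
        exact pow_le_pow_left₀ (by positivity) h.le 2
      have h2 : (∏ t, R (k t)) ≤ (∏ t, R (k t)) * (∑ t, X (k t)) ^ 2 / (n * δ) ^ 2 := by
        rw [le_div_iff₀ hs]
        exact mul_le_mul_of_nonneg_left this hp
      linarith
  refine le_trans ?_ (Finset.sum_le_sum fun k _ => hle k)
  rw [Finset.sum_sub_distrib, m1, ← Finset.sum_div, m3]
  have : n * Vv / (n * δ) ^ 2 ≤ 1 / 2 := by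
    rw [div_le_iff₀ hs]
    rw [div_le_iff₀ (by positivity)] at hn
    nlinarith
  linarith

theorem tilt_bound {K : Type*} [Fintype K] (R X P Q : K → ℝ) (hR : ∀ k, 0 ≤ R k)
    (h1 : ∑ k, R k = 1) (hX : ∑ k, R k * X k = 0) (δ : ℝ) (hδ : 0 < δ)
    (s a' F : ℝ) (hs0 : 0 ≤ s) (hs1 : s ≤ 1)
    (hP : ∀ k, P k = R k * Real.exp (-F - s * X k))
    (hQ : ∀ k, Q k = R k * Real.exp (a' - F + (1 - s) * X k)) :
    ∀ᶠ n : ℕ in atTop, (1 / 2) * Real.exp (-(n * (F + δ))) ≤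
      ∑ k : Fin n → K, min (∏ t, P (k t)) (Real.exp (-(n * a')) * ∏ t, Q (k t)) := by
  filter_upwards [wlln R X hR h1 hX δ hδ] with n hn
  refine le_trans (mul_le_mul_of_nonneg_right hn (Real.exp_pos _).le) ?_
  rw [Finset.sum_mul]
  refine Finset.sum_le_sum fun k _ => ?_
  have hp : 0 ≤ ∏ t, R (k t) := Finset.prod_nonneg fun t _ => hR _
  have eP : ∏ t, P (k t) = (∏ t, R (k t)) * Real.exp (-(n * F) - s * ∑ t, X (k t)) := by
    simp only [hP, Finset.prod_mul_distrib, ← Real.exp_sum, Finset.sum_sub_distrib,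
      ← Finset.mul_sum]
    simp
  have eQ : Real.exp (-(n * a')) * ∏ t, Q (k t)
      = (∏ t, R (k t)) * Real.exp (-(n * F) + (1 - s) * ∑ t, X (k t)) := by
    simp only [hQ, Finset.prod_mul_distrib, ← Real.exp_sum, Finset.sum_add_distrib,
      ← Finset.mul_sum]
    rw [mul_left_comm, ← Real.exp_add]
    congr 2
    simp
    ring
  rw [eP, eQ]
  split_ifs with h
  · obtain ⟨g1, g2⟩ := abs_le.mp h
    have hnδ : 0 ≤ n * δ := le_trans (abs_nonneg _) h
    refine le_min (mul_le_mul_of_nonneg_left (Real.exp_le_exp.mpr ?_) hp)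
      (mul_le_mul_of_nonneg_left (Real.exp_le_exp.mpr ?_) hp)
    · nlinarith [mul_le_mul_of_nonneg_left g2 hs0, mul_le_mul_of_nonneg_right hs1 hnδ]
    · nlinarith [mul_le_mul_of_nonneg_left g1 (sub_nonneg.mpr hs1),
        mul_nonneg hs0 hnδ]
  · rw [zero_mul]
    positivity

theorem abstract_converse {K : Type*} [Fintype K] (W p q : K → ℝ) (hW : ∀ k, 0 ≤ W k)
    (φ : ℝ → ℝ)
    (hφ : ∀ s, φ s = Real.log (∑ k, W k * Real.exp ((1 - s) * p k + s * q k)))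
    (hp1 : ∑ k, W k * Real.exp (p k) = 1) (hq1 : ∑ k, W k * Real.exp (q k) = 1)
    (a Φ : ℝ)
    (hΦ : Φ = ⨆ s : Set.Icc (0 : ℝ) 1, (a * (s : ℝ) - φ (s : ℝ)))
    (ha1 : ∑ k, W k * Real.exp (p k) * (q k - p k) ≤ a)
    (ha2 : a < ∑ k, W k * Real.exp (q k) * (q k - p k))
    (α β : ℕ → ℝ) (hα0 : ∀ n, 0 ≤ α n) (hα1 : ∀ n, α n ≤ 1)
    (hβ0 : ∀ n, 0 ≤ β n) (hβ1 : ∀ n, β n ≤ 1)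
    (hab : ∀ n c, 0 ≤ c → (1 / 2) * ∑ k : Fin n → K, min (∏ t, (W (k t) * Real.exp (p (k t))))
      (c * ∏ t, (W (k t) * Real.exp (q (k t)))) ≤ α n + c * β n)
    (hβ : limsup (fun n : ℕ => (1 / (n : ℝ)) * Real.log (β n)) atTop ≤ -(Φ - a)) :
    -Φ ≤ liminf (fun n : ℕ => (1 / (n : ℝ)) * Real.log (α n)) atTop := by
  set Z : ℝ → ℝ := fun s => ∑ k, W k * Real.exp ((1 - s) * p k + s * q k) with hZ
  set f : ℝ → ℝ := fun s =>
    (∑ k, W k * Real.exp ((1 - s) * p k + s * q k) * (q k - p k)) / Z s with hf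
  have hZpos : ∀ s, 0 < Z s := by
    intro s
    have hne : ∃ k, 0 < W k := by
      by_contra hcon
      push Not at hcon
      have : ∀ k, W k = 0 := fun k => le_antisymm (hcon k) (hW k)
      simp [this] at hp1
    obtain ⟨k, hk⟩ := hne
    exact Finset.sum_pos' (fun k _ => mul_nonneg (hW k) (Real.exp_pos _).le)
      ⟨k, Finset.mem_univ k, mul_pos hk (Real.exp_pos _)⟩
  have hZc : Continuous Z := by
    simp only [hZ]; fun_prop
  have hfc : Continuous f := by
    simp only [hf]
    refine Continuous.div (by fun_prop) hZc fun s => (hZpos s).ne'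
  have hf0 : f 0 ≤ a := by
    have : Z 0 = 1 := by simpa [hZ] using hp1
    simp only [hf, this, div_one]
    simpa using ha1
  have hf1 : a < f 1 := by
    have : Z 1 = 1 := by simpa [hZ] using hq1
    simp only [hf, this, div_one]
    simpa using ha2
  have hφc : Continuous φ := by
    have : φ = fun s => Real.log (Z s) := funext hφ
    rw [this]
    exact hZc.log fun s => (hZpos s).ne'
  have hsup : ∀ s ∈ Set.Icc (0:ℝ) 1, a * s - φ s ≤ Φ := by
    intro s hs
    rw [hΦ]
    refine le_ciSup (f := fun s : Set.Icc (0 : ℝ) 1 => a * (s : ℝ) - φ (s : ℝ)) ?_ ⟨s, hs⟩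
    have : IsCompact (Set.range fun s : Set.Icc (0 : ℝ) 1 => a * (s : ℝ) - φ (s : ℝ)) :=
      isCompact_range (by fun_prop)
    exact this.bddAbove
  refine le_of_forall_pos_le_add fun ε hε => ?_
  -- choice of `a'` and `s`
  obtain ⟨a', ha', ha''⟩ : ∃ a', a < a' ∧ a' < min (a + ε / 2) (f 1) :=
    exists_between (lt_min (by linarith) hf1)
  obtain ⟨hae, haf⟩ := lt_min_iff.mp ha''
  obtain ⟨s, hs, hfs⟩ : a' ∈ f '' Set.Icc 0 1 :=
    intermediate_value_Icc zero_le_one hfc.continuousOn ⟨by linarith, haf.le⟩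
  have hs1 : s < 1 := by
    rcases lt_or_eq_of_le hs.2 with h | h
    · exact h
    · rw [h] at hfs; linarith
  have hF := hsup s hs
  set F := a' * s - φ s with hFd
  set η := (a' - a) * (1 - s) with hη
  have hηpos : 0 < η := mul_pos (by linarith) (by linarith)
  have hFΨ : F - a' + η ≤ Φ - a := by
    have : F - a' + η = a * s - φ s - a := by rw [hFd, hη]; ring
    linarith
  have hFΦ : F ≤ Φ + ε / 2 := by
    have : F = a * s - φ s + (a' - a) * s := by rw [hFd]; ring
    nlinarith [hs.1, hs.2]
  set δ := min (η / 4) (ε / 4) with hδd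
  have hδ : 0 < δ := lt_min (by linarith) (by linarith)
  have hδη : δ ≤ η / 4 := min_le_left _ _
  have hδε : δ ≤ ε / 4 := min_le_right _ _
  have hφZ : Real.exp (φ s) = Z s := by rw [hφ, Real.exp_log (hZpos s)]
  have hfs' : ∑ k, W k * Real.exp ((1 - s) * p k + s * q k) * (q k - p k) = a' * Z s := by
    rw [← hfs]; simp only [hf]; rw [div_mul_cancel₀ _ (hZpos s).ne']
  have hbound := tilt_bound (K := K)
    (fun k => W k * Real.exp ((1 - s) * p k + s * q k) / Z s) (fun k => q k - p k - a')
    (fun k => W k * Real.exp (p k)) (fun k => W k * Real.exp (q k))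
    (fun k => div_nonneg (mul_nonneg (hW k) (Real.exp_pos _).le) (hZpos s).le)
    (by rw [← Finset.sum_div]; exact div_self (hZpos s).ne')
    (by
      have : ∀ k, W k * Real.exp ((1 - s) * p k + s * q k) / Z s * (q k - p k - a')
          = (W k * Real.exp ((1 - s) * p k + s * q k) * (q k - p k)
            - a' * (W k * Real.exp ((1 - s) * p k + s * q k))) / Z s := fun k => by ring
      simp only [this]
      rw [← Finset.sum_div, Finset.sum_sub_distrib, hfs', ← Finset.mul_sum]
      simp [hZ])
    δ hδ s a' F hs.1 hs.2
    (by
      intro k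
      rw [← hφZ, mul_div_assoc, ← Real.exp_sub, mul_assoc, ← Real.exp_add]
      congr 2
      rw [hFd]; ring)
    (by
      intro k
      rw [← hφZ, mul_div_assoc, ← Real.exp_sub, mul_assoc, ← Real.exp_add]
      congr 2
      rw [hFd]; ring)
  have hlogle : ∀ (n : ℕ) (x : ℝ), 0 ≤ x → x ≤ 1 → (1 / (n:ℝ)) * Real.log x ≤ 0 := by
    intro n x h0 h1
    exact mul_nonpos_of_nonneg_of_nonpos (by positivity) (Real.log_nonpos h0 h1)
  have hβev : ∀ᶠ n : ℕ in atTop, (1 / (n : ℝ)) * Real.log (β n) < -(Φ - a) + δ := by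
    refine eventually_lt_of_limsup_lt (lt_of_le_of_lt hβ (by linarith)) ?_
    exact isBoundedUnder_of ⟨0, fun n => hlogle n _ (hβ0 n) (hβ1 n)⟩
  have hexp : ∀ᶠ n : ℕ in atTop, Real.log 8 / δ ≤ (n:ℝ) :=
    tendsto_natCast_atTop_atTop.eventually_ge_atTop _
  suffices hmain : -Φ - ε ≤ liminf (fun n : ℕ => (1 / (n : ℝ)) * Real.log (α n)) atTop by
    linarith
  refine le_liminf_of_le ?_ ?_
  · exact (isBoundedUnder_of ⟨0, fun n => hlogle n _ (hα0 n) (hα1 n)⟩ :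
      IsBoundedUnder (· ≤ ·) atTop _).isCoboundedUnder_ge
  filter_upwards [hbound, hβev, hexp, eventually_gt_atTop 0] with n hb hbe he hn0
  have hn : (0:ℝ) < n := by exact_mod_cast hn0
  rw [div_le_iff₀ hδ] at he
  have hab' := hab n (Real.exp (-(n * a'))) (Real.exp_pos _).le
  have hβn : β n ≤ Real.exp (n * (-(Φ - a) + δ)) := by
    rcases (hβ0 n).eq_or_lt with h | h
    · rw [← h]; exact (Real.exp_pos _).le
    · rw [← Real.log_le_iff_le_exp h]
      rw [one_div, inv_mul_lt_iff₀ hn] at hbe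
      exact hbe.le
  have h8 : Real.exp (-(n * δ)) ≤ 1 / 8 := by
    rw [Real.exp_neg, one_div]
    refine inv_anti₀ (by norm_num) ?_
    rw [← Real.log_le_iff_le_exp (by norm_num)]
    exact he
  have hcb : Real.exp (-(n * a')) * β n ≤ Real.exp (-(n * (F + δ))) * (1 / 8) := by
    calc Real.exp (-(n * a')) * β n
        ≤ Real.exp (-(n * a')) * Real.exp (n * (-(Φ - a) + δ)) :=
          mul_le_mul_of_nonneg_left hβn (Real.exp_pos _).le
      _ = Real.exp (n * (-a' -(Φ - a) + δ)) := by rw [← Real.exp_add]; congr 1; ring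
      _ ≤ Real.exp (n * (-(F + δ) - δ)) :=
          Real.exp_le_exp.mpr (mul_le_mul_of_nonneg_left (by linarith) hn.le)
      _ = Real.exp (-(n * (F + δ))) * Real.exp (-(n * δ)) := by
          rw [← Real.exp_add]; congr 1; ring
      _ ≤ _ := mul_le_mul_of_nonneg_left h8 (Real.exp_pos _).le
  have hαn : Real.exp (-(n * (F + δ))) * Real.exp (-(n * δ)) ≤ α n := by
    have := mul_le_mul_of_nonneg_left h8 (Real.exp_pos (-(n * (F + δ)))).le
    linarith
  rw [← Real.exp_add] at hαn
  have hlog := (Real.le_log_iff_exp_le (lt_of_lt_of_le (Real.exp_pos _) hαn)).mpr hαn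
  rw [one_div, le_inv_mul_iff₀ hn]
  refine le_trans ?_ hlog
  have : -(n * (F + δ)) + -(n * δ) = n * (-F - 2 * δ) := by ring
  rw [this]
  exact mul_le_mul_of_nonneg_left (by linarith) hn.le

theorem spectral {N : Type*} [Fintype N] [DecidableEq N] (A : Matrix N N ℂ)
    (h : A.IsHermitian) :
    A = (h.eigenvectorUnitary : Matrix N N ℂ) *
      Matrix.diagonal (fun i => ((h.eigenvalues i : ℝ) : ℂ)) *
      (h.eigenvectorUnitary : Matrix N N ℂ)ᴴ := by
  have := h.spectral_theorem
  rw [Unitary.conjStarAlgAut_apply] at this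
  exact this

theorem tp_spec {d : ℕ} (U : Matrix (Fin d) (Fin d) ℂ) (a : Fin d → ℝ) (n : ℕ) :
    tensorPow (U * Matrix.diagonal (fun i => (a i : ℂ)) * Uᴴ) n
     = tensorPow U n * Matrix.diagonal (fun v : Fin n → Fin d => ((∏ t, a (v t) : ℝ) : ℂ)) *
      (tensorPow U n)ᴴ := by
  rw [← tp_mul, ← tp_mul, tp_diag, tp_star]

theorem tp_trace {d : ℕ} (A : Matrix (Fin d) (Fin d) ℂ) (n : ℕ) (h : A.trace = 1) :
    (tensorPow A n).trace = 1 := by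
  have : (tensorPow A n).trace = ∏ _t : Fin n, A.trace := by
    simp only [Matrix.trace, Matrix.diag_apply, tensorPow]
    rw [Finset.prod_univ_sum]
    simp
  rw [this, h]; simp

theorem converse_core {d : ℕ} (ρ σ U V : Matrix (Fin d) (Fin d) ℂ) (l m : Fin d → ℝ)
    (hl : ∀ i, 0 < l i) (hm : ∀ i, 0 < m i)
    (hU : U * Uᴴ = 1) (hV : V * Vᴴ = 1)
    (hρ : ρ = U * Matrix.diagonal (fun i => (l i : ℂ)) * Uᴴ)
    (hσ : σ = V * Matrix.diagonal (fun i => (m i : ℂ)) * Vᴴ)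
    (hρp : ∀ t, mpow ρ t = U * Matrix.diagonal (fun i => ((l i ^ t : ℝ) : ℂ)) * Uᴴ)
    (hσp : ∀ t, mpow σ t = V * Matrix.diagonal (fun i => ((m i ^ t : ℝ) : ℂ)) * Vᴴ)
    (hρl : mlog ρ = U * Matrix.diagonal (fun i => ((Real.log (l i) : ℝ) : ℂ)) * Uᴴ)
    (hσl : mlog σ = V * Matrix.diagonal (fun i => ((Real.log (m i) : ℝ) : ℂ)) * Vᴴ)
    (hρ1 : ρ.trace = 1) (hσ1 : σ.trace = 1)
    (Φ a : ℝ)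
    (hΦ : Φ = ⨆ s : Set.Icc (0 : ℝ) 1, (a * (s : ℝ) - qphi ρ σ (s : ℝ)))
    (ha1 : -(qRelEnt ρ σ) ≤ a) (ha2 : a < qRelEnt σ ρ)
    (T : (n : ℕ) → Matrix (Fin n → Fin d) (Fin n → Fin d) ℂ)
    (hT : ∀ n, (T n).PosSemidef ∧ (1 - T n).PosSemidef)
    (hβ : limsup (fun n : ℕ =>
        (1 / (n : ℝ)) * Real.log (((tensorPow σ n * T n).trace).re)) atTop ≤ -(Φ - a)) :
    -Φ ≤ liminf (fun n : ℕ =>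
        (1 / (n : ℝ)) * Real.log (((tensorPow ρ n * (1 - T n)).trace).re)) atTop := by
  set W : Fin d × Fin d → ℝ := fun k => ‖(Uᴴ * V) k.1 k.2‖ ^ 2 with hWd
  have hUU : Uᴴ * U = 1 := mul_eq_one_comm.mp hU
  have hVV : Vᴴ * V = 1 := mul_eq_one_comm.mp hV
  -- Hilbert-Schmidt pairing as a sum over pairs
  have tr2 : ∀ x y : Fin d → ℝ,
      ((U * Matrix.diagonal (fun i => (x i : ℂ)) * Uᴴ) *
      (V * Matrix.diagonal (fun i => (y i : ℂ)) * Vᴴ)).trace.re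
      = ∑ k : Fin d × Fin d, W k * (x k.1 * y k.2) := by
    intro x y
    rw [trace_two, Fintype.sum_prod_type]
    exact Finset.sum_congr rfl fun i _ => Finset.sum_congr rfl fun j _ => mul_comm _ _
  have one_U : U * Matrix.diagonal (fun _ => ((1:ℝ):ℂ)) * Uᴴ = 1 := by simp [hU]
  have one_V : V * Matrix.diagonal (fun _ => ((1:ℝ):ℂ)) * Vᴴ = 1 := by simp [hV]
  have trU : ∀ x : Fin d → ℝ, (U * Matrix.diagonal (fun i => (x i : ℂ)) * Uᴴ).trace.re
      = ∑ k : Fin d × Fin d, W k * x k.1 := by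
    intro x
    have := tr2 x (fun _ => 1)
    rw [one_V] at this
    simpa only [mul_one] using this
  have trV : ∀ x : Fin d → ℝ, (V * Matrix.diagonal (fun i => (x i : ℂ)) * Vᴴ).trace.re
      = ∑ k : Fin d × Fin d, W k * x k.2 := by
    intro x
    have := tr2 (fun _ => 1) x
    rw [one_U] at this
    simpa only [one_mul] using this
  have mulU : ∀ x y : Fin d → ℝ, (U * Matrix.diagonal (fun i => (x i : ℂ)) * Uᴴ) *
      (U * Matrix.diagonal (fun i => (y i : ℂ)) * Uᴴ) =
      U * Matrix.diagonal (fun i => ((x i * y i : ℝ) : ℂ)) * Uᴴ := by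
    intro x y
    calc _ = U * Matrix.diagonal (fun i => (x i : ℂ)) * (Uᴴ * U) *
        Matrix.diagonal (fun i => (y i : ℂ)) * Uᴴ := by simp only [Matrix.mul_assoc]
      _ = _ := by
        rw [hUU, Matrix.mul_one, Matrix.mul_assoc U, Matrix.diagonal_mul_diagonal]
        simp only [Complex.ofReal_mul]
  have mulV : ∀ x y : Fin d → ℝ, (V * Matrix.diagonal (fun i => (x i : ℂ)) * Vᴴ) *
      (V * Matrix.diagonal (fun i => (y i : ℂ)) * Vᴴ) =
      V * Matrix.diagonal (fun i => ((x i * y i : ℝ) : ℂ)) * Vᴴ := by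
    intro x y
    calc _ = V * Matrix.diagonal (fun i => (x i : ℂ)) * (Vᴴ * V) *
        Matrix.diagonal (fun i => (y i : ℂ)) * Vᴴ := by simp only [Matrix.mul_assoc]
      _ = _ := by
        rw [hVV, Matrix.mul_one, Matrix.mul_assoc V, Matrix.diagonal_mul_diagonal]
        simp only [Complex.ofReal_mul]
  have hρn : ∀ n, tensorPow ρ n = tensorPow U n *
      Matrix.diagonal (fun v : Fin n → Fin d => ((∏ t, l (v t) : ℝ) : ℂ)) *
      (tensorPow U n)ᴴ := fun n => by rw [hρ, tp_spec]
  have hσn : ∀ n, tensorPow σ n = tensorPow V n *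
      Matrix.diagonal (fun v : Fin n → Fin d => ((∏ t, m (v t) : ℝ) : ℂ)) *
      (tensorPow V n)ᴴ := fun n => by rw [hσ, tp_spec]
  have hln : ∀ n (v : Fin n → Fin d), 0 ≤ ∏ t, l (v t) :=
    fun n v => Finset.prod_nonneg fun t _ => (hl _).le
  have hmn : ∀ n (v : Fin n → Fin d), 0 ≤ ∏ t, m (v t) :=
    fun n v => Finset.prod_nonneg fun t _ => (hm _).le
  have posρ : ∀ n M, M.PosSemidef → 0 ≤ (tensorPow ρ n * M).trace.re := fun n M hM => by
    rw [hρn]; exact trace_diag_nonneg _ M _ (hln n) hM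
  have posσ : ∀ n M, M.PosSemidef → 0 ≤ (tensorPow σ n * M).trace.re := fun n M hM => by
    rw [hσn]; exact trace_diag_nonneg _ M _ (hmn n) hM
  refine abstract_converse W (fun k => Real.log (l k.1)) (fun k => Real.log (m k.2))
    (fun k => by positivity) (qphi ρ σ) ?_ ?_ ?_ a Φ hΦ ?_ ?_
    (fun n => ((tensorPow ρ n * (1 - T n)).trace).re)
    (fun n => ((tensorPow σ n * T n).trace).re) ?_ ?_ ?_ ?_ ?_ hβ
  · intro s
    rw [qphi, hρp, hσp, tr2]
    congr 1
    refine Finset.sum_congr rfl fun k _ => ?_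
    rw [Real.exp_add, Real.rpow_def_of_pos (hl _), Real.rpow_def_of_pos (hm _),
      mul_comm (1 - s), mul_comm s]
  · have := trU l
    rw [← hρ, hρ1] at this
    simp only [Real.exp_log (hl _)]
    simpa using this.symm
  · have := trV m
    rw [← hσ, hσ1] at this
    simp only [Real.exp_log (hm _)]
    simpa using this.symm
  · refine le_trans (le_of_eq ?_) ha1
    rw [qRelEnt, Matrix.mul_sub, Matrix.trace_sub, Complex.sub_re, hρl, hσl, hρ, mulU, trU, tr2,
      ← Finset.sum_sub_distrib, ← Finset.sum_neg_distrib]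
    refine Finset.sum_congr rfl fun k _ => ?_
    rw [Real.exp_log (hl _)]
    ring
  · refine lt_of_lt_of_eq ha2 ?_
    rw [qRelEnt, Matrix.mul_sub, Matrix.trace_sub, Complex.sub_re, hρl, hσl, hσ,
      Matrix.trace_mul_comm _ (U * _ * _), mulV, trV, tr2,
      ← Finset.sum_sub_distrib]
    refine Finset.sum_congr rfl fun k _ => ?_
    rw [Real.exp_log (hm _)]
    ring
  · exact fun n => posρ n _ (hT n).2
  · intro n
    have := posρ n _ (hT n).1
    have h1 := tp_trace ρ n hρ1
    simp only [Matrix.mul_sub, Matrix.mul_one, Matrix.trace_sub, h1, Complex.sub_re,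
      Complex.one_re]
    linarith
  · exact fun n => posσ n _ (hT n).1
  · intro n
    have := posσ n _ (hT n).2
    have h1 := tp_trace σ n hσ1
    simp only [Matrix.mul_sub, Matrix.mul_one, Matrix.trace_sub, h1, Complex.sub_re,
      Complex.one_re] at this
    linarith
  · intro n c hc
    have hUn : tensorPow U n * (tensorPow U n)ᴴ = 1 := by
      rw [tp_star, tp_mul, hU, tp_one]
    have hVn : tensorPow V n * (tensorPow V n)ᴴ = 1 := by
      rw [tp_star, tp_mul, hV, tp_one]
    have := test_bound (tensorPow U n) (tensorPow V n) (T n) _ _ (hln n) (hmn n) hUn hVn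
      (hT n).1 (hT n).2 c hc
    rw [← hρn, ← hσn] at this
    refine le_trans (le_of_eq ?_) this
    congr 1
    rw [← (Equiv.arrowProdEquivProdArrow (Fin n) (fun _ => Fin d) (fun _ => Fin d)).symm.sum_comp,
      Fintype.sum_prod_type]
    refine Finset.sum_congr rfl fun v _ => Finset.sum_congr rfl fun w _ => ?_
    have eW : ‖((tensorPow U n)ᴴ * tensorPow V n) v w‖ ^ 2 = ∏ t, W (v t, w t) := by
      rw [tp_star, tp_mul]
      simp only [tensorPow, norm_prod, hWd, Finset.prod_pow]
    rw [eW, min_mul_of_nonneg _ _ (Finset.prod_nonneg fun t _ => by positivity)]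
    simp only [Equiv.arrowProdEquivProdArrow, Equiv.coe_fn_symm_mk, Real.exp_log (hl _),
      Real.exp_log (hm _), Finset.prod_mul_distrib]
    congr 1 <;> ring

/-- Converse part of the quantum Hoeffding bound (in the parametrization by `a`):
if `limsup (1/n)·log βₙ[Tₙ] ≤ −Ψ(a)` then `liminf (1/n)·log αₙ[Tₙ] ≥ −a − Ψ(a)`,
for `a ∈ [−D(ρ‖σ), D(σ‖ρ))`, where `Φ(a) = max_{0≤s≤1}(a·s − φ(s))` and `Ψ(a) = Φ(a) − a`. -/
theorem converse_hoeffding_param {d : ℕ} (ρ σ : Matrix (Fin d) (Fin d) ℂ)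
    (hρ : ρ.PosDef) (hρ1 : ρ.trace = 1)
    (hσ : σ.PosDef) (hσ1 : σ.trace = 1)
    (Φ Ψ : ℝ → ℝ)
    (hΦ : ∀ a, Φ a = ⨆ s : Set.Icc (0 : ℝ) 1, (a * (s : ℝ) - qphi ρ σ (s : ℝ)))
    (hΨ : ∀ a, Ψ a = Φ a - a)
    (a : ℝ) (ha1 : -(qRelEnt ρ σ) ≤ a) (ha2 : a < qRelEnt σ ρ)
    (T : (n : ℕ) → Matrix (Fin n → Fin d) (Fin n → Fin d) ℂ)
    (hT : ∀ n, (T n).PosSemidef ∧ (1 - T n).PosSemidef)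
    (hβ : limsup (fun n : ℕ =>
        (1 / (n : ℝ)) * Real.log (((tensorPow σ n * T n).trace).re)) atTop ≤ -(Ψ a)) :
    -a - Ψ a ≤ liminf (fun n : ℕ =>
        (1 / (n : ℝ)) * Real.log (((tensorPow ρ n * (1 - T n)).trace).re)) atTop := by
  have h1 := spectral ρ hρ.1
  have h2 := spectral σ hσ.1
  have hu : ∀ (A : Matrix (Fin d) (Fin d) ℂ) (h : A.IsHermitian),
      (h.eigenvectorUnitary : Matrix (Fin d) (Fin d) ℂ) *
        (h.eigenvectorUnitary : Matrix (Fin d) (Fin d) ℂ)ᴴ = 1 := fun A h =>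
    Unitary.mul_star_self_of_mem h.eigenvectorUnitary.2
  rw [hΨ] at hβ ⊢
  have key := converse_core ρ σ _ _ _ _ hρ.eigenvalues_pos hσ.eigenvalues_pos
    (hu ρ hρ.1) (hu σ hσ.1) h1 h2
    (fun t => by rw [mpow, dif_pos hρ.1]; rfl) (fun t => by rw [mpow, dif_pos hσ.1]; rfl)
    (by rw [mlog, dif_pos hρ.1]; rfl) (by rw [mlog, dif_pos hσ.1]; rfl)
    hρ1 hσ1 (Φ a) a (hΦ a) ha1 ha2 T hT hβ
  refine le_trans (le_of_eq ?_) key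
  ring
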